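/- Consider the curved 3-body problem in H³ with three equal masses m > 0 and an Eulerian candidate of negative elliptic-hyperbolic form: q_1 = (0, 0, sinh β, cosh β), q_2 = (r cos α, r sin α, ρ sinh β, ρ cosh β), q_3 = (−r cos α, −r sin α, ρ sinh β, ρ cosh β), where ρ := (1 + r²)^{1/2}, r(t) > 0, and α, β are nonconstant. If (q_1, q_2, q_3) solves the equations of motion in H³, then r (and hence ρ) is constant in t, so all mutual Lorentz products q_12 = q_13 = −(1 + r²)^{1/2} and q_23 = −1 − 2r² are constant, i.e., every such solution is a relative equilibrium; moreover there are constants d_1, d_2 with α̇ = d_1/(2 m r²) and β̇ = d_2/(m (3 + 2 r²)), and the total angular momenta relative to the wy-, wz-, xy-, and xz-planes vanish. -/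

import Mathlib

open Real Finset

section SecondDerivatives

variable {f g : ℝ → ℝ}

lemma hasDerivAt_deriv_of_contDiff_two (hf : ContDiff ℝ 2 f) (t : ℝ) :
    HasDerivAt f (deriv f t) t ∧ HasDerivAt (deriv f) (deriv (deriv f) t) t := by
  have h : ContDiff ℝ (1 + 1) f := by simpa [one_add_one_eq_two] using hf
  exact ⟨(hf.differentiable (by norm_num) t).hasDerivAt,
    (((contDiff_succ_iff_deriv.1 h).2.2).differentiable (by norm_num) t).hasDerivAt⟩

/-- Second derivative of `f * (u ∘ g)`, where `u' = v` and `v' = ε u`. -/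
lemma deriv_deriv_mul_comp {u v : ℝ → ℝ} {ε : ℝ} (hu : ∀ x, HasDerivAt u (v x) x)
    (hv : ∀ x, HasDerivAt v (ε * u x) x) (hf : ContDiff ℝ 2 f) (hg : ContDiff ℝ 2 g) (t : ℝ) :
    deriv (deriv fun t => f t * u (g t)) t =
      (deriv (deriv f) t + ε * f t * deriv g t ^ 2) * u (g t) +
        (2 * deriv f t * deriv g t + f t * deriv (deriv g) t) * v (g t) := by
  have h1 : (deriv fun t => f t * u (g t)) =
      fun t => deriv f t * u (g t) + f t * (v (g t) * deriv g t) := funext fun s =>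
    ((hasDerivAt_deriv_of_contDiff_two hf s).1.mul
      ((hu (g s)).comp s (hasDerivAt_deriv_of_contDiff_two hg s).1)).deriv
  obtain ⟨hf1, hf2⟩ := hasDerivAt_deriv_of_contDiff_two hf t
  obtain ⟨hg1, hg2⟩ := hasDerivAt_deriv_of_contDiff_two hg t
  rw [h1]
  refine ((hf2.mul ((hu (g t)).comp t hg1)).add
    (hf1.mul (((hv (g t)).comp t hg1).mul hg2))).deriv.trans ?_
  simp only [Function.comp_apply, Pi.mul_apply]
  ring

lemma cosh_mul_deriv_deriv_sub_sinh_mul_deriv_deriv (hf : ContDiff ℝ 2 f) (hg : ContDiff ℝ 2 g)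
    (t : ℝ) :
    Real.cosh (g t) * deriv (deriv fun t => f t * Real.sinh (g t)) t -
      Real.sinh (g t) * deriv (deriv fun t => f t * Real.cosh (g t)) t =
      2 * deriv f t * deriv g t + f t * deriv (deriv g) t := by
  rw [deriv_deriv_mul_comp (ε := 1) Real.hasDerivAt_sinh
      (fun x => by simpa using Real.hasDerivAt_cosh x) hf hg,
    deriv_deriv_mul_comp (ε := 1) Real.hasDerivAt_cosh
      (fun x => by simpa using Real.hasDerivAt_sinh x) hf hg]
  linear_combination (2 * deriv f t * deriv g t + f t * deriv (deriv g) t) *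
    Real.cosh_sq_sub_sinh_sq (g t)

lemma cos_mul_deriv_deriv_sub_sin_mul_deriv_deriv (hf : ContDiff ℝ 2 f) (hg : ContDiff ℝ 2 g)
    (t : ℝ) :
    Real.cos (g t) * deriv (deriv fun t => f t * Real.sin (g t)) t -
      Real.sin (g t) * deriv (deriv fun t => f t * Real.cos (g t)) t =
      2 * deriv f t * deriv g t + f t * deriv (deriv g) t := by
  rw [deriv_deriv_mul_comp (ε := -1) (v := Real.cos) Real.hasDerivAt_sin
      (fun x => by simpa using Real.hasDerivAt_cos x) hf hg,
    deriv_deriv_mul_comp (ε := -1) (v := fun x => -Real.sin x) Real.hasDerivAt_cos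
      (fun x => by simpa using (Real.hasDerivAt_sin x).fun_neg) hf hg]
  linear_combination (2 * deriv f t * deriv g t + f t * deriv (deriv g) t) *
    Real.cos_sq_add_sin_sq (g t)

lemma deriv_eq_of_deriv_deriv_eq_zero (hf : ContDiff ℝ 2 f) (h : ∀ t, deriv (deriv f) t = 0)
    (s t : ℝ) : deriv f s = deriv f t :=
  is_const_of_deriv_eq_zero
    (fun x => (hasDerivAt_deriv_of_contDiff_two hf x).2.differentiableAt) h s t

end SecondDerivatives

/-- Negative elliptic-hyperbolic Eulerian orbits of the 3-body problem in H³
are relative equilibria. -/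
theorem negative_elliptic_hyperbolic_three_body
    (m : ℝ) (hm : 0 < m)
    (α β r ρ : ℝ → ℝ)
    (hαC : ContDiff ℝ 2 α) (hβC : ContDiff ℝ 2 β) (hrC : ContDiff ℝ 2 r)
    (hαnc : ∃ t₁ t₂, α t₁ ≠ α t₂) (hβnc : ∃ t₁ t₂, β t₁ ≠ β t₂)
    (hρ : ∀ t, ρ t = Real.sqrt (1 + r t ^ 2))
    (hrpos : ∀ t, 0 < r t)
    (W X Y Z : Fin 3 → ℝ → ℝ)
    (hW0 : ∀ t, W 0 t = 0)
    (hW1 : ∀ t, W 1 t = r t * cos (α t))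
    (hW2 : ∀ t, W 2 t = -(r t * cos (α t)))
    (hX0 : ∀ t, X 0 t = 0)
    (hX1 : ∀ t, X 1 t = r t * sin (α t))
    (hX2 : ∀ t, X 2 t = -(r t * sin (α t)))
    (hY0 : ∀ t, Y 0 t = Real.sinh (β t))
    (hY1 : ∀ t, Y 1 t = ρ t * Real.sinh (β t))
    (hY2 : ∀ t, Y 2 t = ρ t * Real.sinh (β t))
    (hZ0 : ∀ t, Z 0 t = Real.cosh (β t))
    (hZ1 : ∀ t, Z 1 t = ρ t * Real.cosh (β t))
    (hZ2 : ∀ t, Z 2 t = ρ t * Real.cosh (β t))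
    (q : Fin 3 → Fin 3 → ℝ → ℝ)
    (hq : ∀ i j t, q i j t =
      W i t * W j t + X i t * X j t + Y i t * Y j t - Z i t * Z j t)
    (hreg : ∀ i j, i ≠ j → ∀ t, q i j t ^ 2 ≠ 1)
    -- (q₁,q₂,q₃) solves the equations of motion in H³
    (hsol : ∀ f : Fin 3 → ℝ → ℝ, (f = W ∨ f = X ∨ f = Y ∨ f = Z) → ∀ i t,
        deriv (deriv (f i)) t =
          (∑ j ∈ Finset.univ.erase i,
            m * (f j t + q i j t * f i t) / (q i j t ^ 2 - 1) ^ ((3:ℝ)/2))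
          + (deriv (W i) t ^ 2 + deriv (X i) t ^ 2 + deriv (Y i) t ^ 2
              - deriv (Z i) t ^ 2) * f i t) :
    -- r (and hence ρ) is constant in t
    (∀ t₁ t₂, r t₁ = r t₂) ∧ (∀ t₁ t₂, ρ t₁ = ρ t₂) ∧
    -- mutual Lorentz products
    (∀ t, q 0 1 t = -Real.sqrt (1 + r t ^ 2) ∧
          q 0 2 t = -Real.sqrt (1 + r t ^ 2) ∧
          q 1 2 t = -1 - 2 * r t ^ 2) ∧
    (∀ i j, ∀ t₁ t₂, q i j t₁ = q i j t₂) ∧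
    -- angular velocities
    (∃ d₁ d₂ : ℝ,
      (∀ t, deriv α t = d₁ / (2 * m * r t ^ 2)) ∧
      (∀ t, deriv β t = d₂ / (m * (3 + 2 * r t ^ 2)))) ∧
    -- angular momenta relative to the wy-, wz-, xy-, xz-planes vanish
    (∀ t,
      (∑ i, m * (W i t * deriv (Y i) t - deriv (W i) t * Y i t) = 0) ∧
      (∑ i, m * (W i t * deriv (Z i) t - deriv (W i) t * Z i t) = 0) ∧
      (∑ i, m * (X i t * deriv (Y i) t - deriv (X i) t * Y i t) = 0) ∧
      (∑ i, m * (X i t * deriv (Z i) t - deriv (X i) t * Z i t) = 0)) := by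
  have hρpos : ∀ t, 0 < ρ t := fun t => by rw [hρ]; positivity
  have hρsq : ∀ t, ρ t ^ 2 = 1 + r t ^ 2 := fun t => by rw [hρ, Real.sq_sqrt (by positivity)]
  have hρC : ContDiff ℝ 2 ρ := by
    rw [funext hρ]
    exact (contDiff_const.add (hrC.pow 2)).sqrt fun t => by positivity
  have e0 : univ.erase (0 : Fin 3) = {1, 2} := by decide
  have e1 : univ.erase (1 : Fin 3) = {0, 2} := by decide
  -- the middle body moves with constant speed along a geodesic
  have hβ'' : ∀ t, deriv (deriv β) t = 0 := fun t => by
    have h := cosh_mul_deriv_deriv_sub_sinh_mul_deriv_deriv (f := fun _ => 1)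
      contDiff_const hβC t
    have hY := hsol Y (by simp) 0 t
    have hZ := hsol Z (by simp) 0 t
    rw [e0, sum_pair (by decide), hY0 t, hY1 t, hY2 t] at hY
    rw [e0, sum_pair (by decide), hZ0 t, hZ1 t, hZ2 t] at hZ
    simp only [one_mul, deriv_const, mul_zero, zero_mul, zero_add] at h
    rw [← funext hY0, ← funext hZ0, hY, hZ] at h
    rw [← h]
    ring
  have hβ' := deriv_eq_of_deriv_deriv_eq_zero hβC hβ''
  have hβne : ∀ t, deriv β t ≠ 0 := fun t h0 => by
    obtain ⟨t₁, t₂, hne⟩ := hβnc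
    exact hne (is_const_of_deriv_eq_zero (hβC.differentiable (by norm_num))
      (fun s => (hβ' s t).trans h0) t₁ t₂)
  have hρ' : ∀ t, deriv ρ t = 0 := fun t => by
    have h := cosh_mul_deriv_deriv_sub_sinh_mul_deriv_deriv hρC hβC t
    have hY := hsol Y (by simp) 1 t
    have hZ := hsol Z (by simp) 1 t
    rw [e1, sum_pair (by decide), hY0 t, hY1 t, hY2 t] at hY
    rw [e1, sum_pair (by decide), hZ0 t, hZ1 t, hZ2 t] at hZ
    rw [← funext hY1, ← funext hZ1, hY, hZ, hβ'' t] at h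
    have h2 : 2 * deriv β t * deriv ρ t = 0 := by linear_combination -h
    simpa [hβne t] using h2
  have hρconst : ∀ t₁ t₂, ρ t₁ = ρ t₂ :=
    is_const_of_deriv_eq_zero (hρC.differentiable (by norm_num)) hρ'
  have hrconst : ∀ t₁ t₂, r t₁ = r t₂ := fun t₁ t₂ => by
    have h : r t₁ ^ 2 = r t₂ ^ 2 := by
      have := hρsq t₁
      rw [hρconst t₁ t₂, hρsq t₂] at this
      linarith
    exact (pow_left_inj₀ (hrpos t₁).le (hrpos t₂).le two_ne_zero).1 h
  have hr' : ∀ t, deriv r t = 0 := fun t => by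
    rw [funext fun s => hrconst s 0]
    exact deriv_const t _
  have hα'' : ∀ t, deriv (deriv α) t = 0 := fun t => by
    have h := cos_mul_deriv_deriv_sub_sin_mul_deriv_deriv hrC hαC t
    have hX := hsol X (by simp) 1 t
    have hW := hsol W (by simp) 1 t
    rw [e1, sum_pair (by decide), hX0 t, hX1 t, hX2 t] at hX
    rw [e1, sum_pair (by decide), hW0 t, hW1 t, hW2 t] at hW
    rw [← funext hX1, ← funext hW1, hX, hW, hr' t] at h
    have h2 : r t * deriv (deriv α) t = 0 := by linear_combination -h
    simpa [(hrpos t).ne'] using h2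
  have hα' := deriv_eq_of_deriv_deriv_eq_zero hαC hα''
  have hq01 : ∀ t, q 0 1 t = -ρ t := fun t => by
    rw [hq, hW0, hX0, hY0, hZ0, hY1, hZ1]
    linear_combination -ρ t * Real.cosh_sq_sub_sinh_sq (β t)
  have hq02 : ∀ t, q 0 2 t = -ρ t := fun t => by
    rw [hq, hW0, hX0, hY0, hZ0, hY2, hZ2]
    linear_combination -ρ t * Real.cosh_sq_sub_sinh_sq (β t)
  have hq12 : ∀ t, q 1 2 t = -1 - 2 * r t ^ 2 := fun t => by
    rw [hq, hW1, hX1, hY1, hZ1, hW2, hX2, hY2, hZ2]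
    linear_combination -ρ t ^ 2 * Real.cosh_sq_sub_sinh_sq (β t)
      - r t ^ 2 * Real.cos_sq_add_sin_sq (α t) - hρsq t
  have hq00 : ∀ t, q 0 0 t = -1 := fun t => by
    rw [hq, hW0, hX0, hY0, hZ0]
    linear_combination -Real.cosh_sq_sub_sinh_sq (β t)
  have hq11 : ∀ t, q 1 1 t = -1 := fun t => by
    rw [hq, hW1, hX1, hY1, hZ1]
    linear_combination -ρ t ^ 2 * Real.cosh_sq_sub_sinh_sq (β t)
      + r t ^ 2 * Real.cos_sq_add_sin_sq (α t) - hρsq t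
  have hq22 : ∀ t, q 2 2 t = -1 := fun t => by
    rw [hq, hW2, hX2, hY2, hZ2]
    linear_combination -ρ t ^ 2 * Real.cosh_sq_sub_sinh_sq (β t)
      + r t ^ 2 * Real.cos_sq_add_sin_sq (α t) - hρsq t
  have hqsymm : ∀ i j t, q i j t = q j i t := fun i j t => by
    rw [hq, hq]
    ring
  refine ⟨hrconst, hρconst, fun t => ⟨hρ t ▸ hq01 t, hρ t ▸ hq02 t, hq12 t⟩, ?_,
    ⟨2 * m * r 0 ^ 2 * deriv α 0, m * (3 + 2 * r 0 ^ 2) * deriv β 0, fun t => ?_, fun t => ?_⟩,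
    fun t => ?_⟩
  · intro i j t₁ t₂
    fin_cases i <;> fin_cases j <;>
      simp [hq00, hq11, hq22, hq01, hq02, hq12, hqsymm 1 0, hqsymm 2 0, hqsymm 2 1,
        hρconst t₁ t₂, hrconst t₁ t₂]
  · have := (hrpos t).ne'
    rw [hrconst 0 t, hα' 0 t]
    field_simp
  · have : 3 + 2 * r t ^ 2 ≠ 0 := by positivity
    rw [hrconst 0 t, hβ' 0 t]
    field_simp
  · have dW0 : deriv (W 0) t = 0 := by rw [funext hW0]; exact deriv_const t _
    have dX0 : deriv (X 0) t = 0 := by rw [funext hX0]; exact deriv_const t _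
    have dW2 : deriv (W 2) t = -deriv (W 1) t := by
      rw [funext hW2, funext hW1]; exact deriv.fun_neg
    have dX2 : deriv (X 2) t = -deriv (X 1) t := by
      rw [funext hX2, funext hX1]; exact deriv.fun_neg
    have hY : Y 2 = Y 1 := (funext hY2).trans (funext hY1).symm
    have hZ : Z 2 = Z 1 := (funext hZ2).trans (funext hZ1).symm
    refine ⟨?_, ?_, ?_, ?_⟩ <;> rw [Fin.sum_univ_three]
    · rw [hW0, dW0, hW2, ← hW1, dW2, hY]; ring
    · rw [hW0, dW0, hW2, ← hW1, dW2, hZ]; ring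
    · rw [hX0, dX0, hX2, ← hX1, dX2, hY]; ring
    · rw [hX0, dX0, hX2, ← hX1, dX2, hZ]; ring
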